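/- Assume the nondegeneracy condition h₀₁² + h₀₂² + h₁₂² ≠ 0 at λ̄ and that r² > h₁₂². Then for every ε > 0 there exists a neighbourhood O^ε of λ̄ in ℝ³ × ℝ³ such that every extremal whose image is contained in O^ε is defined on a time interval of length less than ε (i.e., the time any extremal spends inside O^ε is less than ε). -/

import Mathlib

noncomputable section

open MeasureTheory Real Set

/-- The state space: ℝ³, realized as `Fin 3 → ℝ`. -/
abbrev E3 : Type := Fin 3 → ℝ

/-- Euclidean inner product on ℝ³. -/
def dot3 (a b : E3) : ℝ := ∑ i, a i * b i

/-- Lie bracket of two vector fields: `[f, g](x) = Dg(x) f(x) − Df(x) g(x)`. -/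
def lie (f g : E3 → E3) : E3 → E3 :=
  fun x => fderiv ℝ g x (f x) - fderiv ℝ f x (g x)

/-- The control set: the closed unit disk in ℝ². -/
def U2 : Set (ℝ × ℝ) := {u | u.1 ^ 2 + u.2 ^ 2 ≤ 1}

/-- An admissible control on the time set `I`: measurable with values in the unit disk.
(Essential boundedness is automatic since `U2` is bounded.) -/
def AdmControl (u : ℝ → ℝ × ℝ) (I : Set ℝ) : Prop :=
  Measurable u ∧ ∀ t ∈ I, u t ∈ U2

/-- An admissible trajectory of `q̇ = f₀(q) + u₁ f₁(q) + u₂ f₂(q)` on `I`,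
with control `u`: locally Lipschitz (here: Lipschitz on `I`) and satisfying
the ODE almost everywhere on `I`. -/
def IsTraj (f0 f1 f2 : E3 → E3) (u : ℝ → ℝ × ℝ) (q : ℝ → E3) (I : Set ℝ) : Prop :=
  (∃ K, LipschitzOnWith K q I) ∧
  ∀ᵐ t, t ∈ I → HasDerivAt q
    (f0 (q t) + (u t).1 • f1 (q t) + (u t).2 • f2 (q t)) t

/-- `q : [0, t₁] → ℝ³` is a time-optimal trajectory: it is an admissible trajectory,
and no admissible trajectory joins `q 0` to `q t₁` in time strictly less than `t₁`. -/
def TimeOpt (f0 f1 f2 : E3 → E3) (q : ℝ → E3) (t1 : ℝ) : Prop :=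
  0 ≤ t1 ∧
  (∃ u, AdmControl u (Icc 0 t1) ∧ IsTraj f0 f1 f2 u q (Icc 0 t1)) ∧
  ¬ ∃ s, 0 ≤ s ∧ s < t1 ∧ ∃ u p, AdmControl u (Icc 0 s) ∧
      IsTraj f0 f1 f2 u p (Icc 0 s) ∧ p 0 = q 0 ∧ p s = q t1

/-- For `λ = (ξ, x)`, the Hamiltonian lift `h_f(λ) = ⟨ξ, f(x)⟩` of a vector field `f`. -/
def hF (f : E3 → E3) (l : E3 × E3) : ℝ := dot3 l.1 (f l.2)

/-- The (pre-maximized) Hamiltonian `h₀ + v₁ h₁ + v₂ h₂` at `λ`, for a control value `v`. -/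
def Ham (f0 f1 f2 : E3 → E3) (v : ℝ × ℝ) (l : E3 × E3) : ℝ :=
  hF f0 l + v.1 * hF f1 l + v.2 * hF f2 l

/-- A Pontryagin extremal `λ(t) = (ξ(t), x(t))` with control `u` on the time set `I`:
locally Lipschitz, `ξ(t) ≠ 0`, satisfying a.e. the Hamiltonian system
`x' = f₀(x) + u₁ f₁(x) + u₂ f₂(x)`,
`ξ' = −(Df₀(x) + u₁ Df₁(x) + u₂ Df₂(x))ᵀ ξ` (expressed via the inner product),
the maximality condition, and nonnegativity of the maximized Hamiltonian. -/
def IsExtremal (f0 f1 f2 : E3 → E3) (u : ℝ → ℝ × ℝ) (lam : ℝ → E3 × E3)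
    (I : Set ℝ) : Prop :=
  (∃ K, LipschitzOnWith K lam I) ∧
  AdmControl u I ∧
  (∀ t ∈ I, (lam t).1 ≠ 0) ∧
  ∀ᵐ t, t ∈ I →
    (HasDerivAt (fun s => (lam s).2)
      (f0 ((lam t).2) + (u t).1 • f1 ((lam t).2) + (u t).2 • f2 ((lam t).2)) t) ∧
    (∃ w : E3, HasDerivAt (fun s => (lam s).1) w t ∧
      ∀ v : E3, dot3 w v =
        - dot3 ((lam t).1)
          (fderiv ℝ f0 ((lam t).2) v + (u t).1 • fderiv ℝ f1 ((lam t).2) v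
            + (u t).2 • fderiv ℝ f2 ((lam t).2) v)) ∧
    (∀ v ∈ U2, Ham f0 f1 f2 v (lam t) ≤ Ham f0 f1 f2 (u t) (lam t)) ∧
    0 ≤ Ham f0 f1 f2 (u t) (lam t)

/-- The singular locus `Λ = {(ξ, x) : ⟨ξ, f₁(x)⟩ = ⟨ξ, f₂(x)⟩ = 0}`. -/
def SingLocus (f1 f2 : E3 → E3) : Set (E3 × E3) :=
  {l | hF f1 l = 0 ∧ hF f2 l = 0}

theorem continuous_hF {f : E3 → E3} (hf : Continuous f) : Continuous (hF f) := by
  unfold hF dot3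
  fun_prop

theorem contDiff_hF {f : E3 → E3} {n : WithTop ℕ∞} (hf : ContDiff ℝ n f) :
    ContDiff ℝ n (hF f) := by
  unfold hF dot3
  fun_prop

theorem continuous_lie {f g : E3 → E3} (hf : ContDiff ℝ 1 f) (hg : ContDiff ℝ 1 g) :
    Continuous (lie f g) := by
  have hf' := hf.continuous_fderiv one_ne_zero
  have hg' := hg.continuous_fderiv one_ne_zero
  exact (hg'.clm_apply hf.continuous).sub (hf'.clm_apply hg.continuous)

theorem hasDerivAt_hF_comp {f : E3 → E3} {lam : ℝ → E3 × E3} {w v : E3} {t : ℝ}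
    (hf : DifferentiableAt ℝ f (lam t).2)
    (hw : HasDerivAt (fun s => (lam s).1) w t) (hv : HasDerivAt (fun s => (lam s).2) v t) :
    HasDerivAt (fun s => hF f (lam s))
      (dot3 w (f (lam t).2) + dot3 (lam t).1 (fderiv ℝ f (lam t).2 v)) t := by
  have hfv : HasDerivAt (fun s => f (lam s).2) (fderiv ℝ f (lam t).2 v) t :=
    hf.hasFDerivAt.comp_hasDerivAt t hv
  have := HasDerivAt.fun_sum (u := Finset.univ) fun i _ =>
    (hasDerivAt_pi.1 hw i).mul (hasDerivAt_pi.1 hfv i)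
  rw [Finset.sum_add_distrib] at this
  exact this

/-- Along the Hamiltonian flow of `h₀ + u₁ h₁ + u₂ h₂`, the lift of `f` has derivative
`⟨ξ, [f₀, f]⟩ + u₁ ⟨ξ, [f₁, f]⟩ + u₂ ⟨ξ, [f₂, f]⟩`. -/
theorem hasDerivAt_hF_hamiltonian {f0 f1 f2 f : E3 → E3} {lam : ℝ → E3 × E3} {w : E3}
    {c : ℝ × ℝ} {t : ℝ} (hf : DifferentiableAt ℝ f (lam t).2)
    (hx : HasDerivAt (fun s => (lam s).2)
      (f0 (lam t).2 + c.1 • f1 (lam t).2 + c.2 • f2 (lam t).2) t)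
    (hw : HasDerivAt (fun s => (lam s).1) w t)
    (hadj : ∀ v : E3, dot3 w v = - dot3 (lam t).1
      (fderiv ℝ f0 (lam t).2 v + c.1 • fderiv ℝ f1 (lam t).2 v
        + c.2 • fderiv ℝ f2 (lam t).2 v)) :
    HasDerivAt (fun s => hF f (lam s))
      (hF (lie f0 f) (lam t) + c.1 * hF (lie f1 f) (lam t) + c.2 * hF (lie f2 f) (lam t)) t := by
  convert hasDerivAt_hF_comp hf hw hx using 1
  rw [hadj]
  simp only [hF, lie, dot3, Fin.sum_univ_three, map_add, map_smul, Pi.add_apply, Pi.sub_apply,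
    Pi.smul_apply, smul_eq_mul]
  ring

theorem hF_lie_self (f : E3 → E3) (l : E3 × E3) : hF (lie f f) l = 0 := by
  simp [hF, lie, dot3]

theorem hF_lie_swap (f g : E3 → E3) (l : E3 × E3) : hF (lie g f) l = - hF (lie f g) l := by
  simp only [hF, lie, dot3, Fin.sum_univ_three, Pi.sub_apply]
  ring

/-- A Lipschitz function whose derivative is almost everywhere at least `c` grows at rate at
least `c`. -/
theorem LipschitzOnWith.mul_sub_le_of_ae_hasDerivAt {φ : ℝ → ℝ} {K : NNReal} {a b c : ℝ}
    (hab : a ≤ b) (hφ : LipschitzOnWith K φ (Icc a b))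
    (hder : ∀ᵐ t, t ∈ Icc a b → ∃ d, HasDerivAt φ d t ∧ c ≤ d) :
    c * (b - a) ≤ φ b - φ a := by
  have hac : AbsolutelyContinuousOnInterval φ a b :=
    LipschitzOnWith.absolutelyContinuousOnInterval (K := K) (by rwa [uIcc_of_le hab])
  rw [← hac.integral_deriv_eq_sub]
  have hle : ∫ _ in a..b, c ≤ ∫ t in a..b, deriv φ t := by
    refine intervalIntegral.integral_mono_ae_restrict hab intervalIntegrable_const
      hac.intervalIntegrable_deriv ?_
    refine (ae_restrict_iff' measurableSet_Icc).2 ?_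
    filter_upwards [hder] with t ht hmem
    obtain ⟨d, hd, hcd⟩ := ht hmem
    rwa [hd.deriv]
  simpa [mul_comm] using hle

/-- For `v` in the unit disk, `g₁ v₂ - g₂ v₁` is bounded by the Euclidean norm of `g`. -/
theorem abs_cross_le_sqrt_of_mem_U2 {v : ℝ × ℝ} (hv : v ∈ U2) (x y : ℝ) :
    |y * v.1 - x * v.2| ≤ √(x ^ 2 + y ^ 2) := by
  have hv' : v.1 ^ 2 + v.2 ^ 2 ≤ 1 := hv
  refine Real.abs_le_sqrt ?_
  nlinarith [sq_nonneg (x * v.1 + y * v.2), mul_le_mul_of_nonneg_left hv'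
    (add_nonneg (sq_nonneg x) (sq_nonneg y))]

/-- **Proposition 4.7.** Under `h₀₁² + h₀₂² + h₁₂² ≠ 0` and
`r² > h₁₂²`, for every `ε > 0` there is a neighbourhood `Oᵉ` of `λ̄` such that every
extremal whose image is contained in `Oᵉ` is defined on a time interval of length
less than `ε`. -/
theorem statement12 (f0 f1 f2 : E3 → E3)
    (hf0 : ContDiff ℝ (⊤ : ℕ∞) f0) (hf1 : ContDiff ℝ (⊤ : ℕ∞) f1) (hf2 : ContDiff ℝ (⊤ : ℕ∞) f2)
    (hli : ∀ q : E3, LinearIndependent ℝ ![f1 q, f2 q])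
    (qb : E3) (lb : E3 × E3) (h01 h02 h12 r : ℝ)
    (hlb : lb = (crossProduct (f1 qb) (f2 qb), qb))
    (hh01 : h01 = hF (lie f0 f1) lb) (hh02 : h02 = hF (lie f0 f2) lb)
    (hh12 : h12 = hF (lie f1 f2) lb) (hr : r = Real.sqrt (h01 ^ 2 + h02 ^ 2))
    (hnondeg : h01 ^ 2 + h02 ^ 2 + h12 ^ 2 ≠ 0)
    (hgt : r ^ 2 > h12 ^ 2) :
    ∀ ε : ℝ, 0 < ε →
      ∃ O : Set (E3 × E3), IsOpen O ∧ lb ∈ O ∧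
        ∀ (a b : ℝ) (u : ℝ → ℝ × ℝ) (lam : ℝ → E3 × E3),
          a ≤ b →
          IsExtremal f0 f1 f2 u lam (Icc a b) →
          (∀ t ∈ Icc a b, lam t ∈ O) →
          b - a < ε := by
  intro ε hε
  have hf0' : ContDiff ℝ 1 f0 := hf0.of_le (by exact_mod_cast le_top)
  have hf1' : ContDiff ℝ 1 f1 := hf1.of_le (by exact_mod_cast le_top)
  have hf2' : ContDiff ℝ 1 f2 := hf2.of_le (by exact_mod_cast le_top)
  have hr0 : 0 ≤ r := hr ▸ Real.sqrt_nonneg _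
  have hrsq : r ^ 2 = h01 ^ 2 + h02 ^ 2 := by
    rw [hr]
    exact Real.sq_sqrt (by positivity)
  have hlt : |h12| < r := abs_lt_of_sq_lt_sq hgt hr0
  have hrpos : 0 < r := (abs_nonneg _).trans_lt hlt
  set G : E3 × E3 → ℝ := fun l =>
    h01 * hF (lie f0 f1) l + h02 * hF (lie f0 f2) l - r * |hF (lie f1 f2) l| with hG
  set φ : E3 × E3 → ℝ := fun l => h01 * hF f1 l + h02 * hF f2 l with hφ
  have hGcont : Continuous G := by
    have c01 := continuous_hF (continuous_lie hf0' hf1')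
    have c02 := continuous_hF (continuous_lie hf0' hf2')
    have c12 := continuous_hF (continuous_lie hf1' hf2')
    fun_prop
  have hφdiff : ContDiff ℝ 1 φ := by
    have c1 := contDiff_hF hf1'
    have c2 := contDiff_hF hf2'
    fun_prop
  have hGpos : 0 < G lb := by
    simp only [hG, ← hh01, ← hh02, ← hh12]
    nlinarith [mul_pos hrpos (sub_pos.2 hlt)]
  obtain ⟨c, hc0, hcG⟩ := exists_between hGpos
  obtain ⟨K, S, hS, hKS⟩ := (hφdiff.contDiffAt (x := lb)).exists_lipschitzOnWith
  have hδ : 0 < c * ε / 2 := by positivity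
  refine ⟨interior S ∩ {l | c < G l} ∩ {l | |φ l - φ lb| < c * ε / 2},
    (isOpen_interior.inter (isOpen_lt continuous_const hGcont)).inter
      (isOpen_lt (by have := hφdiff.continuous; fun_prop) continuous_const),
    ⟨⟨mem_interior_iff_mem_nhds.2 hS, hcG⟩, by simpa using hδ⟩, ?_⟩
  intro a b u lam hab hext hO
  obtain ⟨⟨L, hL⟩, hu, -, hode⟩ := hext
  have hlip : LipschitzOnWith (K * L) (φ ∘ lam) (Icc a b) :=
    hKS.comp hL fun t ht => interior_subset (hO t ht).1.1
  have hgrow : c * (b - a) ≤ φ (lam b) - φ (lam a) := by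
    refine hlip.mul_sub_le_of_ae_hasDerivAt hab ?_
    filter_upwards [hode] with t ht hmem
    obtain ⟨hx, ⟨w, hw, hadj⟩, -, -⟩ := ht hmem
    have d1 := hasDerivAt_hF_hamiltonian (hf1'.differentiable one_ne_zero _) hx hw hadj
    have d2 := hasDerivAt_hF_hamiltonian (hf2'.differentiable one_ne_zero _) hx hw hadj
    refine ⟨_, (d1.const_mul h01).add (d2.const_mul h02), (hO t hmem).1.2.le.trans ?_⟩
    rw [hF_lie_self, hF_lie_self, hF_lie_swap f1 f2]
    have hcross := hr ▸ abs_cross_le_sqrt_of_mem_U2 (hu.2 t hmem) h01 h02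
    have hprod := mul_le_mul_of_nonneg_right hcross (abs_nonneg (hF (lie f1 f2) (lam t)))
    rw [← abs_mul] at hprod
    have := neg_le_of_abs_le hprod
    simp only [hG]
    linarith
  have hA := abs_lt.1
    (show |φ (lam a) - φ lb| < c * ε / 2 from (hO a (left_mem_Icc.2 hab)).2)
  have hB := abs_lt.1
    (show |φ (lam b) - φ lb| < c * ε / 2 from (hO b (right_mem_Icc.2 hab)).2)
  have : c * (b - a) < c * ε := by linarith [hA.1, hB.2]
  exact lt_of_mul_lt_mul_left this hc0.le
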